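/- Let f be a non-constant Boolean function with s_1(f) = 2 and s_0(f) ≥ 3. Then C_0(f) ≤ 2·s_0(f) − 2. -/

import Mathlib

/-- The input `x` with its `i`-th coordinate flipped. -/
def flipCoord {n : ℕ} (x : Fin n → Bool) (i : Fin n) : Fin n → Bool :=
  Function.update x i (!(x i))

/-- The sensitivity `s(f, x)` of a Boolean function `f` on input `x`:
the number of coordinates whose flip changes the value of `f`. -/
def sensAt {n : ℕ} (f : (Fin n → Bool) → Bool) (x : Fin n → Bool) : ℕ :=
  (Finset.univ.filter fun i => f (flipCoord x i) ≠ f x).card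

/-- The `b`-sensitivity `s_b(f)`: the maximum of `s(f, x)` over inputs `x` with `f x = b`. -/
def bSens {n : ℕ} (f : (Fin n → Bool) → Bool) (b : Bool) : ℕ :=
  (Finset.univ.filter fun x => f x = b).sup (sensAt f)

/-- The certificate complexity `C(f, x)`: the minimum size of a set `P` of coordinates
such that fixing the coordinates in `P` to their values in `x` forces the value of `f`. -/
noncomputable def certAt {n : ℕ} (f : (Fin n → Bool) → Bool) (x : Fin n → Bool) : ℕ :=
  sInf {k | ∃ P : Finset (Fin n), P.card = k ∧
    ∀ y : Fin n → Bool, (∀ i ∈ P, y i = x i) → f y = f x}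

/-- The `b`-certificate complexity `C_b(f)`: the maximum of `C(f, x)` over `x` with `f x = b`. -/
noncomputable def bCert {n : ℕ} (f : (Fin n → Bool) → Bool) (b : Bool) : ℕ :=
  (Finset.univ.filter fun x => f x = b).sup (certAt f)

/-- A Boolean function is non-constant if it takes two different values. -/
def NonConstant {n : ℕ} (f : (Fin n → Bool) → Bool) : Prop :=
  ∃ x y, f x ≠ f y

lemma flipCoord_same {n : ℕ} (x : Fin n → Bool) (i : Fin n) : flipCoord x i i = !(x i) := by
  simp [flipCoord]

lemma flipCoord_of_ne {n : ℕ} (x : Fin n → Bool) {i j : Fin n} (h : j ≠ i) :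
    flipCoord x i j = x j := by
  simp [flipCoord, h]

lemma flipCoord_flipCoord {n : ℕ} (x : Fin n → Bool) (i : Fin n) :
    flipCoord (flipCoord x i) i = x := by
  simp [flipCoord]

lemma flipCoord_comm {n : ℕ} (x : Fin n → Bool) (i j : Fin n) :
    flipCoord (flipCoord x i) j = flipCoord (flipCoord x j) i := by
  rcases eq_or_ne i j with rfl | h
  · rfl
  · simp only [flipCoord, Function.update_of_ne h, Function.update_of_ne h.symm]
    exact Function.update_comm h _ _ _

lemma flipCoord_cons_zero {n : ℕ} (a : Bool) (y : Fin n → Bool) :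
    flipCoord (Fin.cons a y : Fin (n + 1) → Bool) 0 = Fin.cons (!a) y := by
  simp [flipCoord]

lemma flipCoord_cons_succ {n : ℕ} (a : Bool) (y : Fin n → Bool) (i : Fin n) :
    flipCoord (Fin.cons a y : Fin (n + 1) → Bool) i.succ = Fin.cons a (flipCoord y i) := by
  simp [flipCoord]

/-- A property closed under single flips holds everywhere as soon as it holds somewhere. -/
lemma forall_of_flipCoord {n : ℕ} {p : (Fin n → Bool) → Prop}
    (hp : ∀ x i, p x → p (flipCoord x i)) {x : Fin n → Bool} (hx : p x) (y : Fin n → Bool) :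
    p y := by
  have key : ∀ A : Finset (Fin n), p (A.piecewise y x) := by
    intro A
    induction A using Finset.induction_on with
    | empty => simpa using hx
    | insert a A ha ih =>
      rw [Finset.piecewise_insert]
      by_cases hya : y a = A.piecewise y x a
      · rwa [hya, Function.update_eq_self]
      · have : y a = !(A.piecewise y x a) := by
          revert hya; cases y a <;> cases A.piecewise y x a <;> simp
        rw [this]
        exact hp _ a ih
  simpa using key Finset.univ

/-- The same on the half-cube `x j = b`. -/
lemma forall_of_flipCoord_half {n : ℕ} {p : (Fin n → Bool) → Prop} {j : Fin n} {b : Bool}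
    (hp : ∀ x i, i ≠ j → x j = b → p x → p (flipCoord x i)) {x : Fin n → Bool} (hxj : x j = b)
    (hx : p x) {y : Fin n → Bool} (hy : y j = b) : p y := by
  have key := forall_of_flipCoord (p := fun w => p (Function.update w j b)) (x := x) ?_ ?_ y
  · simpa [← hy] using key
  · intro w i hw
    rcases eq_or_ne i j with rfl | hij
    · simpa [flipCoord] using hw
    · have := hp _ i hij (by simp) hw
      simp only [flipCoord, Function.update_of_ne hij] at this ⊢
      rwa [Function.update_comm hij]
  · simpa [← hxj] using hx

/-- The number of inputs accepted by `g`. -/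
def countTrue {n : ℕ} (g : (Fin n → Bool) → Bool) : ℕ := ∑ x, if g x = true then 1 else 0

lemma countTrue_succ {n : ℕ} (g : (Fin (n + 1) → Bool) → Bool) :
    countTrue g = countTrue (fun y => g (Fin.cons false y)) +
      countTrue (fun y => g (Fin.cons true y)) := by
  unfold countTrue
  rw [← (Fin.consEquiv fun _ => Bool).sum_comp, Fintype.sum_prod_type, Fintype.sum_bool, add_comm]
  rfl

lemma countTrue_of_forall {n : ℕ} {g : (Fin n → Bool) → Bool} (h : ∀ x, g x = true) :
    countTrue g = 2 ^ n := by
  simp [countTrue, h]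

lemma two_mul_countTrue_literal {n : ℕ} {g : (Fin n → Bool) → Bool} {j : Fin n} {b : Bool}
    (h : ∀ x, g x = true ↔ x j = b) : 2 * countTrue g = 2 ^ n := by
  have hinv : Function.Involutive (fun x : Fin n → Bool => flipCoord x j) :=
    fun x => flipCoord_flipCoord x j
  have h1 : countTrue g = ∑ x, if g (flipCoord x j) = true then 1 else 0 :=
    (Equiv.sum_comp hinv.toPerm fun x => if g x = true then 1 else 0).symm
  have h2 : countTrue g + countTrue g = ∑ _x : Fin n → Bool, 1 := by
    nth_rewrite 2 [h1]
    rw [countTrue, ← Finset.sum_add_distrib]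
    refine Finset.sum_congr rfl fun x _ => ?_
    simp only [h, flipCoord_same]
    cases x j <;> cases b <;> rfl
  simp at h2
  omega

/-- Every accepted input of `g` has at most one sensitive coordinate. -/
def UniqueSens {n : ℕ} (g : (Fin n → Bool) → Bool) : Prop :=
  ∀ x i j, g x = true → g (flipCoord x i) = false → g (flipCoord x j) = false → i = j

lemma UniqueSens.cons {n : ℕ} {g : (Fin (n + 1) → Bool) → Bool} (hg : UniqueSens g) (a : Bool) :
    UniqueSens fun y => g (Fin.cons a y) := by
  intro x i j hx hi hj
  have := hg (Fin.cons a x) i.succ j.succ hx (by rwa [flipCoord_cons_succ])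
    (by rwa [flipCoord_cons_succ])
  simpa using this

lemma UniqueSens.cons_flipCoord {n : ℕ} {g : (Fin (n + 1) → Bool) → Bool} (hg : UniqueSens g)
    {a : Bool} {y : Fin n → Bool} (hy : g (Fin.cons a y) = true)
    (hy' : g (Fin.cons (!a) y) = false) (i : Fin n) : g (Fin.cons a (flipCoord y i)) = true := by
  by_contra h
  have := hg (Fin.cons a y) 0 i.succ hy (by rwa [flipCoord_cons_zero])
    (by rw [flipCoord_cons_succ]; simpa using h)
  exact (Fin.succ_ne_zero i) this.symm

lemma UniqueSens.literal_of_slice_false {n : ℕ} {g : (Fin (n + 1) → Bool) → Bool}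
    (hg : UniqueSens g) {a : Bool} (ha : ∀ y, g (Fin.cons (!a) y) = false)
    (hne : ∃ x, g x = true) : ∀ x, g x = true ↔ x 0 = a := by
  obtain ⟨x₀, hx₀⟩ := hne
  rw [← Fin.cons_self_tail x₀] at hx₀
  have h0 : x₀ 0 = a := by
    by_contra h
    have : x₀ 0 = !a := by revert h; cases x₀ 0 <;> cases a <;> simp
    rw [this, ha] at hx₀
    simp at hx₀
  rw [h0] at hx₀
  have hall := forall_of_flipCoord (p := fun y => g (Fin.cons a y) = true)
    (fun y i hy => hg.cons_flipCoord hy (ha y) i) hx₀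
  intro x
  rw [← Fin.cons_self_tail x, Fin.cons_zero]
  by_cases h : x 0 = a
  · simp [h, hall]
  · have : x 0 = !a := by revert h; cases x 0 <;> cases a <;> simp
    simp [this, ha]

lemma UniqueSens.dichotomy_of_slice_literal {n : ℕ} {g : (Fin (n + 1) → Bool) → Bool}
    (hg : UniqueSens g) {a b : Bool} {j : Fin n}
    (hlit : ∀ y : Fin n → Bool, g (Fin.cons a y) = true ↔ y j = b) :
    (∃ j b, ∀ x, g x = true ↔ x j = b) ∨ 3 * 2 ^ (n + 1) ≤ 4 * countTrue g := by
  have hsub : ∀ y : Fin n → Bool, y j = b → g (Fin.cons (!a) y) = true := by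
    intro y hy
    by_contra h
    have h' := hg.cons_flipCoord ((hlit y).2 hy) (by simpa using h) j
    rw [hlit, flipCoord_same, hy] at h'
    simp at h'
  by_cases hex : ∃ y : Fin n → Bool, y j = !b ∧ g (Fin.cons (!a) y) = true
  · right
    obtain ⟨y₀, hy₀, hgy₀⟩ := hex
    have hall : ∀ y : Fin n → Bool, y j = !b → g (Fin.cons (!a) y) = true := by
      intro y hy
      refine forall_of_flipCoord_half (p := fun y => g (Fin.cons (!a) y) = true)
        (fun x i _ hx hgx => hg.cons_flipCoord hgx ?_ i) hy₀ hgy₀ hy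
      have : ¬ g (Fin.cons a x) = true := by rw [hlit, hx]; simp
      simpa using this
    have hfull : countTrue (fun y => g (Fin.cons (!a) y)) = 2 ^ n := by
      refine countTrue_of_forall fun y => ?_
      rcases Bool.eq_or_eq_not (y j) b with h | h
      exacts [hsub y h, hall y h]
    have hhalf := two_mul_countTrue_literal (g := fun y => g (Fin.cons a y)) hlit
    rw [countTrue_succ, pow_succ]
    cases a <;> simp only [Bool.not_true, Bool.not_false] at hfull <;> omega
  · left
    push Not at hex
    refine ⟨j.succ, b, fun x => ?_⟩
    rw [← Fin.cons_self_tail x, Fin.cons_succ]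
    rcases Bool.eq_or_eq_not (x 0) a with h | h
    · rw [h, hlit]
    · rw [h]
      refine ⟨fun hx => ?_, hsub _⟩
      rcases Bool.eq_or_eq_not (Fin.tail x j) b with h | h
      exacts [h, absurd hx (hex _ h)]

/-- A nonzero function all of whose accepted inputs have sensitivity at most one is either a
literal or accepts at least three quarters of the cube. -/
lemma UniqueSens.literal_or_three_quarters {n : ℕ} {g : (Fin n → Bool) → Bool}
    (hg : UniqueSens g) (hne : ∃ x, g x = true) :
    (∃ j b, ∀ x, g x = true ↔ x j = b) ∨ 3 * 2 ^ n ≤ 4 * countTrue g := by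
  induction n with
  | zero =>
    right
    obtain ⟨x, hx⟩ := hne
    rw [countTrue_of_forall fun y => by rwa [Subsingleton.elim y x]]
    norm_num
  | succ n ih =>
    by_cases h0 : ∃ y, g (Fin.cons false y) = true
    · by_cases h1 : ∃ y, g (Fin.cons true y) = true
      · rcases ih (hg.cons false) h0 with ⟨j, b, h⟩ | h0
        · exact hg.dichotomy_of_slice_literal h
        rcases ih (hg.cons true) h1 with ⟨j, b, h⟩ | h1
        · exact hg.dichotomy_of_slice_literal h
        right
        rw [countTrue_succ, pow_succ]
        omega
      · push Not at h1
        exact .inl ⟨0, false, hg.literal_of_slice_false (by simpa using h1) hne⟩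
    · push Not at h0
      exact .inl ⟨0, true, hg.literal_of_slice_false (by simpa using h0) hne⟩

lemma card_le_bSens {n : ℕ} {f : (Fin n → Bool) → Bool} {b : Bool} {x : Fin n → Bool}
    (hx : f x = b) {A : Finset (Fin n)} (hA : ∀ a ∈ A, f (flipCoord x a) ≠ b) :
    A.card ≤ bSens f b := by
  refine le_trans (Finset.card_le_card fun a ha => ?_)
    (Finset.le_sup (f := sensAt f) (by simpa using hx))
  simpa [hx] using hA a ha

lemma flipCoord_eq_true_of_bSens_eq_two {n : ℕ} {f : (Fin n → Bool) → Bool}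
    (hs1 : bSens f true = 2) {x : Fin n → Bool} {i j k : Fin n} (hx : f x = true)
    (hi : f (flipCoord x i) = false) (hj : f (flipCoord x j) = false) (hij : i ≠ j)
    (hik : k ≠ i) (hjk : k ≠ j) : f (flipCoord x k) = true := by
  by_contra hk
  have := card_le_bSens (A := {k, i, j}) hx (by
    intro a ha
    simp only [Finset.mem_insert, Finset.mem_singleton] at ha
    rcases ha with rfl | rfl | rfl
    exacts [hk, by simp [hi], by simp [hj]])
  rw [hs1, Finset.card_insert_of_notMem (by simp [hik, hjk]), Finset.card_pair hij] at this
  omega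

/-- The set of coordinates `P` certifies that `f z = false`, and no subset obtained from it by
removing a single coordinate does. -/
structure IsMinCert {n : ℕ} (f : (Fin n → Bool) → Bool) (z : Fin n → Bool)
    (P : Finset (Fin n)) : Prop where
  cert : ∀ y, (∀ i ∈ P, y i = z i) → f y = false
  minimal : ∀ i ∈ P, ∃ y, (∀ k ∈ P.erase i, y k = z k) ∧ f y = true

lemma exists_isMinCert {n : ℕ} {f : (Fin n → Bool) → Bool} {z : Fin n → Bool}
    (hz : f z = false) : ∃ P, IsMinCert f z P ∧ P.card = certAt f z := by
  obtain ⟨P, hPc, hP⟩ := Nat.sInf_mem (s := {k | ∃ P : Finset (Fin n), P.card = k ∧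
    ∀ y : Fin n → Bool, (∀ i ∈ P, y i = z i) → f y = f z})
    ⟨_, Finset.univ, rfl, fun y hy => by rw [funext fun i => hy i (Finset.mem_univ i)]⟩
  refine ⟨P, ⟨fun y hy => (hP y hy).trans hz, fun i hi => ?_⟩, hPc⟩
  by_contra! hcon
  have hle : certAt f z ≤ (P.erase i).card :=
    Nat.sInf_le ⟨P.erase i, rfl, fun y hy => by simpa [hz] using hcon y hy⟩
  have hlt := Finset.card_erase_lt_of_mem hi
  change P.card = certAt f z at hPc
  omega

/-- The restriction of `f` to the subcube where `P` is set as in `z`, except that `i` is flipped. -/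
def sideFn {n : ℕ} (f : (Fin n → Bool) → Bool) (z : Fin n → Bool) (P : Finset (Fin n))
    (i : Fin n) (x : Fin n → Bool) : Bool :=
  f (flipCoord (P.piecewise z x) i)

lemma piecewise_flipCoord_of_mem {n : ℕ} {P : Finset (Fin n)} (z x : Fin n → Bool) {j : Fin n}
    (hj : j ∈ P) : P.piecewise z (flipCoord x j) = P.piecewise z x := by
  ext k
  by_cases hk : k ∈ P
  · simp [hk]
  · simp [hk, flipCoord_of_ne x (ne_of_mem_of_not_mem hj hk).symm]

lemma piecewise_flipCoord_of_notMem {n : ℕ} {P : Finset (Fin n)} (z x : Fin n → Bool)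
    {j : Fin n} (hj : j ∉ P) :
    P.piecewise z (flipCoord x j) = flipCoord (P.piecewise z x) j := by
  ext k
  rcases eq_or_ne k j with rfl | hkj
  · simp [hj, flipCoord_same]
  · by_cases hk : k ∈ P <;> simp [hk, flipCoord_of_ne _ hkj]

lemma sideFn_flipCoord_of_notMem {n : ℕ} {f : (Fin n → Bool) → Bool} {z : Fin n → Bool}
    {P : Finset (Fin n)} {i j : Fin n} (hj : j ∉ P) (x : Fin n → Bool) :
    sideFn f z P i (flipCoord x j) = f (flipCoord (flipCoord (P.piecewise z x) i) j) := by
  rw [sideFn, piecewise_flipCoord_of_notMem z x hj, flipCoord_comm]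

lemma notMem_of_sideFn_flipCoord_ne {n : ℕ} {f : (Fin n → Bool) → Bool} {z x : Fin n → Bool}
    {P : Finset (Fin n)} {i j : Fin n} (h : sideFn f z P i (flipCoord x j) ≠ sideFn f z P i x) :
    j ∉ P :=
  fun hj => h (by rw [sideFn, sideFn, piecewise_flipCoord_of_mem z x hj])

namespace IsMinCert

variable {n : ℕ} {f : (Fin n → Bool) → Bool} {z : Fin n → Bool} {P : Finset (Fin n)}

lemma piecewise_eq_false (h : IsMinCert f z P) (x : Fin n → Bool) :
    f (P.piecewise z x) = false :=
  h.cert _ fun i hi => by simp [hi]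

lemma exists_sideFn (h : IsMinCert f z P) {i : Fin n} (hi : i ∈ P) :
    ∃ x, sideFn f z P i x = true := by
  obtain ⟨y, hy, hfy⟩ := h.minimal i hi
  refine ⟨y, ?_⟩
  have hyi : y i = !(z i) := by
    rcases Bool.eq_or_eq_not (y i) (z i) with hyi | hyi
    · rw [h.cert y fun k hk => ?_] at hfy
      · simp at hfy
      · rcases eq_or_ne k i with rfl | hki
        exacts [hyi, hy k (Finset.mem_erase.2 ⟨hki, hk⟩)]
    · exact hyi
  have : flipCoord (P.piecewise z y) i = y := by
    ext k
    rcases eq_or_ne k i with rfl | hki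
    · simp [flipCoord_same, hi, hyi]
    · rw [flipCoord_of_ne _ hki]
      by_cases hk : k ∈ P
      · simp [hk, hy k (Finset.mem_erase.2 ⟨hki, hk⟩)]
      · simp [hk]
  rw [sideFn, this, hfy]

lemma sideFn_uniqueSens (h : IsMinCert f z P) (hs1 : bSens f true = 2) {i : Fin n} (hi : i ∈ P) :
    UniqueSens (sideFn f z P i) := by
  intro x j k hx hj hk
  have hjP : j ∉ P := notMem_of_sideFn_flipCoord_ne (by rw [hj, hx]; simp)
  have hkP : k ∉ P := notMem_of_sideFn_flipCoord_ne (by rw [hk, hx]; simp)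
  by_contra hjk
  rw [sideFn_flipCoord_of_notMem hjP] at hj
  rw [sideFn_flipCoord_of_notMem hkP] at hk
  have := flipCoord_eq_true_of_bSens_eq_two hs1 hx hj hk hjk
    (ne_of_mem_of_not_mem hi hjP) (ne_of_mem_of_not_mem hi hkP)
  rw [flipCoord_flipCoord, h.piecewise_eq_false] at this
  simp at this

lemma card_sideFn_le (h : IsMinCert f z P) (x : Fin n → Bool) :
    (P.filter fun i => sideFn f z P i x = true).card ≤ bSens f false :=
  card_le_bSens (h.piecewise_eq_false x) fun a ha => by
    have := (Finset.mem_filter.1 ha).2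
    rw [sideFn] at this
    simp [this]

/-- If the side function of `k` accepts `x` and is sensitive there, then flipping `k` on the
`i`-side yields `true` as well. -/
lemma flipCoord_flipCoord_eq_true (h : IsMinCert f z P) (hs1 : bSens f true = 2)
    {i k j : Fin n} (hi : i ∈ P) (hik : i ≠ k) {x : Fin n → Bool} (hk : k ∈ P)
    (hx : sideFn f z P k x = true) (hj : sideFn f z P k (flipCoord x j) = false) :
    f (flipCoord (flipCoord (P.piecewise z x) i) k) = true := by
  have hjP : j ∉ P := notMem_of_sideFn_flipCoord_ne (by rw [hj, hx]; simp)
  rw [sideFn_flipCoord_of_notMem hjP] at hj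
  rw [flipCoord_comm]
  refine flipCoord_eq_true_of_bSens_eq_two hs1 hx ?_ hj (ne_of_mem_of_not_mem hk hjP) hik
    (ne_of_mem_of_not_mem hi hjP)
  rw [flipCoord_flipCoord, h.piecewise_eq_false]

/-- Counting sensitive coordinates on the `i`-side at an input that the side function of `i`
rejects but is sensitive on. -/
lemma card_lt_bSens {i j : Fin n} {x : Fin n → Bool}
    (hx : sideFn f z P i x = false) (hj : sideFn f z P i (flipCoord x j) = true)
    {A : Finset (Fin n)} (hAP : A ⊆ P)
    (hA : ∀ k ∈ A, f (flipCoord (flipCoord (P.piecewise z x) i) k) = true) :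
    A.card < bSens f false := by
  have hjP : j ∉ P := notMem_of_sideFn_flipCoord_ne (by rw [hj, hx]; simp)
  rw [sideFn_flipCoord_of_notMem hjP] at hj
  have := card_le_bSens (f := f) (b := false) hx (A := insert j A) (by
    intro a ha
    rcases Finset.mem_insert.1 ha with rfl | ha
    · simp [hj]
    · simp [hA a ha])
  rw [Finset.card_insert_of_notMem fun hjA => hjP (hAP hjA)] at this
  omega

variable {H : Finset (Fin n)} {v : Fin n → Fin n} {b : Fin n → Bool}

lemma card_filter_lt_bSens (h : IsMinCert f z P) (hs1 : bSens f true = 2) (hHP : H ⊆ P)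
    (hlit : ∀ i ∈ H, ∀ x, sideFn f z P i x = true ↔ x (v i) = b i) {i : Fin n} (hi : i ∈ H)
    {x : Fin n → Bool} (hx : sideFn f z P i x = false) {B : Finset (Fin n)} (hBP : B ⊆ P)
    (hBH : Disjoint B H)
    (hB : ∀ k ∈ B, f (flipCoord (flipCoord (P.piecewise z x) i) k) = true) :
    (H.filter fun k => sideFn f z P k x = true).card + B.card < bSens f false := by
  have hflip : sideFn f z P i (flipCoord x (v i)) = true := by
    have : ¬ x (v i) = b i := by rw [← hlit i hi, hx]; simp
    rw [hlit i hi, flipCoord_same]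
    exact Bool.not_eq.2 this
  rw [← Finset.card_union_of_disjoint (hBH.symm.mono_left (Finset.filter_subset _ _))]
  refine card_lt_bSens hx hflip
    (Finset.union_subset ((Finset.filter_subset _ _).trans hHP) hBP) fun k hk => ?_
  rcases Finset.mem_union.1 hk with hk | hk
  · obtain ⟨hkH, hkx⟩ := Finset.mem_filter.1 hk
    refine h.flipCoord_flipCoord_eq_true hs1 (j := v k) (hHP hi) ?_ (hHP hkH) hkx ?_
    · rintro rfl
      simp [hx] at hkx
    · rw [← Bool.not_eq_true, hlit k hkH, flipCoord_same, (hlit k hkH x).1 hkx]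
      simp
  · exact hB k hk

lemma flipCoord_flipCoord_eq_false (h : IsMinCert f z P) (hs1 : bSens f true = 2) (hHP : H ⊆ P)
    (hlit : ∀ i ∈ H, ∀ x, sideFn f z P i x = true ↔ x (v i) = b i) {i o : Fin n} (hi : i ∈ H)
    (hoP : o ∈ P) (hoH : o ∉ H) {x : Fin n → Bool} (hx : sideFn f z P i x = false)
    (hcard : bSens f false ≤ (H.filter fun k => sideFn f z P k x = true).card + 1) :
    f (flipCoord (flipCoord (P.piecewise z x) o) i) = false := by
  by_contra hcon
  have := h.card_filter_lt_bSens hs1 hHP hlit hi hx (B := {o}) (by simpa using hoP)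
    (by simpa using hoH) (by
      intro k hk
      rw [Finset.mem_singleton.1 hk, flipCoord_comm]
      simpa using hcon)
  rw [Finset.card_singleton] at this
  omega

lemma card_le_card_filter_add_one (h : IsMinCert f z P) (hs1 : bSens f true = 2) (hHP : H ⊆ P)
    (hlit : ∀ i ∈ H, ∀ x, sideFn f z P i x = true ↔ x (v i) = b i) {o : Fin n}
    (hoP : o ∈ P) (hoH : o ∉ H) {x : Fin n → Bool} (hx : sideFn f z P o x = true)
    (hcard : bSens f false ≤ (H.filter fun k => sideFn f z P k x = true).card + 1) :
    H.card ≤ (H.filter fun k => sideFn f z P k x = true).card + 1 := by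
  rw [← Finset.card_filter_add_card_filter_not (s := H) fun k => sideFn f z P k x = true]
  refine Nat.add_le_add_left (Finset.card_le_one.2 fun i hi k hk => ?_) _
  simp only [Finset.mem_filter, Bool.not_eq_true] at hi hk
  by_contra hik
  have := flipCoord_eq_true_of_bSens_eq_two hs1 hx
    (h.flipCoord_flipCoord_eq_false hs1 hHP hlit hi.1 hoP hoH hi.2 hcard)
    (h.flipCoord_flipCoord_eq_false hs1 hHP hlit hk.1 hoP hoH hk.2 hcard) hik
    (ne_of_mem_of_not_mem hi.1 hoH).symm (ne_of_mem_of_not_mem hk.1 hoH).symm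
  rw [flipCoord_flipCoord, h.piecewise_eq_false] at this
  simp at this

end IsMinCert

lemma sum_card_filter {n : ℕ} (A : Finset (Fin n)) (g : Fin n → (Fin n → Bool) → Bool) :
    ∑ x, (A.filter fun i => g i x = true).card = ∑ i ∈ A, countTrue (g i) := by
  simp only [Finset.card_filter, countTrue]
  exact Finset.sum_comm

/-- Literals that are never simultaneously false include two complementary ones. -/
lemma exists_complementary {n : ℕ} {H : Finset (Fin n)} {v : Fin n → Fin n} {b : Fin n → Bool}
    (h : ∀ x : Fin n → Bool, ∃ i ∈ H, x (v i) = b i) :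
    ∃ i ∈ H, ∃ k ∈ H, v k = v i ∧ b k = !b i := by
  obtain ⟨i, hi, hxi⟩ := h fun j => decide (¬ ∃ k ∈ H, v k = j ∧ b k = true)
  cases hb : b i with
  | true =>
    rw [hb, decide_eq_true_iff] at hxi
    exact absurd ⟨i, hi, rfl, hb⟩ hxi
  | false =>
    rw [hb, decide_eq_false_iff_not, not_not] at hxi
    obtain ⟨k, hk, hv, hbk⟩ := hxi
    exact ⟨i, hi, k, hk, hv, by simp [hb, hbk]⟩

namespace IsMinCert

variable {n : ℕ} {f : (Fin n → Bool) → Bool} {z : Fin n → Bool} {P H O : Finset (Fin n)}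
  {v : Fin n → Fin n} {b : Fin n → Bool}

/-- In the configuration with three literals and two further side functions, one of the latter
is constant. -/
lemma exists_forall_sideFn (h : IsMinCert f z P) (hs1 : bSens f true = 2)
    (hs0 : bSens f false = 3) (hHP : H ⊆ P) (hOP : O ⊆ P) (hdisj : Disjoint H O)
    (hlit : ∀ i ∈ H, ∀ x, sideFn f z P i x = true ↔ x (v i) = b i)
    (hH : H.card = 3) (hO : O.card = 2)
    (hT : ∀ x, (H.filter fun i => sideFn f z P i x = true).card +
      (O.filter fun i => sideFn f z P i x = true).card = 3) :
    ∃ o ∈ O, ∀ x, sideFn f z P o x = true := by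
  have hOle : ∀ x, (O.filter fun i => sideFn f z P i x = true).card ≤ 2 := fun x =>
    hO ▸ Finset.card_filter_le _ _
  obtain ⟨i, hi, k, hk, hv, hb⟩ : ∃ i ∈ H, ∃ k ∈ H, v k = v i ∧ b k = !b i := by
    refine exists_complementary fun x => ?_
    have hpos : 0 < (H.filter fun i => sideFn f z P i x = true).card := by
      have := hT x
      have := hOle x
      omega
    obtain ⟨i, hi⟩ := Finset.card_pos.1 hpos
    obtain ⟨hiH, hix⟩ := Finset.mem_filter.1 hi
    exact ⟨i, hiH, (hlit i hiH x).1 hix⟩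
  have hik : i ≠ k := by
    rintro rfl
    simp at hb
  obtain ⟨c, hc⟩ : ∃ c, H \ {i, k} = {c} := by
    refine Finset.card_eq_one.1 ?_
    rw [Finset.card_sdiff_of_subset (by simp [Finset.insert_subset_iff, hi, hk]), hH,
      Finset.card_pair hik]
  have hcmem : c ∈ H \ {i, k} := by simp [hc]
  have hcH : c ∈ H := (Finset.mem_sdiff.1 hcmem).1
  have hci : c ≠ i ∧ c ≠ k := by simpa using (Finset.mem_sdiff.1 hcmem).2
  have hHeq : H = {i, k, c} := by
    refine (Finset.eq_of_subset_of_card_le ?_ ?_).symm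
    · simp [Finset.insert_subset_iff, hi, hk, hcH]
    · rw [hH, Finset.card_insert_of_notMem (by simp [hik, hci.1.symm]),
        Finset.card_pair hci.2.symm]
  have hkx : ∀ x, sideFn f z P k x = !(sideFn f z P i x) := by
    intro x
    rw [Bool.eq_iff_iff, hlit k hk, hv, hb, Bool.not_eq_true', ← Bool.not_eq_true, hlit i hi]
    exact Bool.eq_not
  have hcount : ∀ x, (H.filter fun i => sideFn f z P i x = true).card =
      1 + if sideFn f z P c x = true then 1 else 0 := by
    intro x
    rw [hHeq, Finset.card_filter, Finset.sum_insert (by simp [hik, hci.1.symm]),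
      Finset.sum_pair hci.2.symm, hkx]
    cases sideFn f z P i x <;> simp
  obtain ⟨x₀, hx₀⟩ := h.exists_sideFn (hHP hcH)
  obtain ⟨o, ho⟩ : ∃ o, o ∈ O.filter fun i => sideFn f z P i x₀ = true := by
    refine Finset.card_pos.1 ?_
    have := hT x₀
    rw [hcount, if_pos hx₀] at this
    omega
  obtain ⟨hoO, hox₀⟩ := Finset.mem_filter.1 ho
  have hoP := hOP hoO
  have hoH : o ∉ H := fun hoH => Finset.disjoint_left.1 hdisj hoH hoO
  refine ⟨o, hoO, fun y => ?_⟩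
  by_cases hcy : sideFn f z P c y = true
  · refine forall_of_flipCoord_half (p := fun y => sideFn f z P o y = true)
      (fun x l _ hxc hox => ?_) ((hlit c hcH x₀).1 hx₀) hox₀ ((hlit c hcH y).1 hcy)
    by_contra hcon
    rw [Bool.not_eq_true] at hcon
    have hlP : l ∉ P := notMem_of_sideFn_flipCoord_ne (by rw [hcon, hox]; simp)
    obtain ⟨e, heH, hex⟩ : ∃ e ∈ H, sideFn f z P e x = false := by
      by_cases hix : sideFn f z P i x = true
      · exact ⟨k, hk, by simp [hkx, hix]⟩
      · exact ⟨i, hi, by simpa using hix⟩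
    have hcard : bSens f false ≤ (H.filter fun k => sideFn f z P k x = true).card + 1 := by
      rw [hcount, if_pos ((hlit c hcH x).2 hxc), hs0]
    rw [sideFn_flipCoord_of_notMem hlP] at hcon
    have := flipCoord_eq_true_of_bSens_eq_two hs1 hox
      (h.flipCoord_flipCoord_eq_false hs1 hHP hlit heH hoP hoH hex hcard) hcon
      (ne_of_mem_of_not_mem (hHP heH) hlP) (ne_of_mem_of_not_mem heH hoH).symm
      (ne_of_mem_of_not_mem hoP hlP)
    rw [flipCoord_flipCoord, h.piecewise_eq_false] at this
    simp at this
  · have hcardy := hT y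
    rw [hcount, if_neg hcy] at hcardy
    have hfull : O.filter (fun i => sideFn f z P i y = true) = O :=
      Finset.eq_of_subset_of_card_le (Finset.filter_subset _ _) (by omega)
    rw [← hfull] at hoO
    exact (Finset.mem_filter.1 hoO).2

/-- A minimal certificate of a `false` value has fewer than `2 * s₀(f) - 1` coordinates. -/
lemma card_le (h : IsMinCert f z P) (hs1 : bSens f true = 2) (hs0 : 3 ≤ bSens f false) :
    P.card ≤ 2 * bSens f false - 2 := by
  classical
  by_contra hlarge
  set s := bSens f false with hs
  have hN : 0 < 2 ^ n := by positivity
  set N := 2 ^ n with hNdef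
  let H := P.filter fun i => ∃ j b, ∀ x, sideFn f z P i x = true ↔ x j = b
  let O := P.filter fun i => ¬ ∃ j b, ∀ x, sideFn f z P i x = true ↔ x j = b
  have hHP : H ⊆ P := Finset.filter_subset _ _
  have hOP : O ⊆ P := Finset.filter_subset _ _
  have hdisj : Disjoint H O := Finset.disjoint_filter_filter_not _ _ _
  have hunion : H ∪ O = P := Finset.filter_union_filter_not_eq _ _
  have hcard : H.card + O.card = P.card := by
    rw [← hunion, Finset.card_union_of_disjoint hdisj]
  have hchoice : ∀ i, ∃ j b, i ∈ H → ∀ x, sideFn f z P i x = true ↔ x j = b := by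
    intro i
    by_cases hi : i ∈ H
    · obtain ⟨j, b, hjb⟩ := (Finset.mem_filter.1 hi).2
      exact ⟨j, b, fun _ => hjb⟩
    · exact ⟨i, true, fun hi' => absurd hi' hi⟩
  choose v b hlit using hchoice
  have hHcount : 2 * ∑ i ∈ H, countTrue (sideFn f z P i) = H.card * N := by
    rw [Finset.mul_sum, Finset.sum_congr rfl fun i hi => two_mul_countTrue_literal (hlit i hi)]
    simp [hNdef]
  have hO34 : ∀ o ∈ O, 3 * N ≤ 4 * countTrue (sideFn f z P o) := fun o ho =>
    ((h.sideFn_uniqueSens hs1 (hOP ho)).literal_or_three_quarters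
      (h.exists_sideFn (hOP ho))).resolve_left (Finset.mem_filter.1 ho).2
  have hOcount : O.card * (3 * N) ≤ 4 * ∑ i ∈ O, countTrue (sideFn f z P i) := by
    rw [Finset.mul_sum, ← smul_eq_mul]
    exact Finset.card_nsmul_le_sum _ _ _ hO34
  have hTle : ∀ x, (H.filter fun i => sideFn f z P i x = true).card +
      (O.filter fun i => sideFn f z P i x = true).card ≤ s := by
    intro x
    rw [← Finset.card_union_of_disjoint (Finset.disjoint_filter_filter hdisj),
      ← Finset.filter_union, hunion]
    exact h.card_sideFn_le x
  have hTsum : ∑ x, ((H.filter fun i => sideFn f z P i x = true).card +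
      (O.filter fun i => sideFn f z P i x = true).card) =
      ∑ i ∈ H, countTrue (sideFn f z P i) + ∑ i ∈ O, countTrue (sideFn f z P i) := by
    rw [Finset.sum_add_distrib, sum_card_filter, sum_card_filter]
  have hconst : ∀ c : ℕ, ∑ _x : Fin n → Bool, c = c * N := by
    intro c
    simp [hNdef, mul_comm]
  have htotal : ∑ i ∈ H, countTrue (sideFn f z P i) + ∑ i ∈ O, countTrue (sideFn f z P i) ≤
      s * N := by
    rw [← hTsum, ← hconst]
    exact Finset.sum_le_sum fun x _ => hTle x
  have hHO : 2 * H.card + 3 * O.card ≤ 4 * s := by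
    refine Nat.le_of_mul_le_mul_right ?_ hN
    linarith
  have hHlt : s < H.card → ∀ x, (H.filter fun i => sideFn f z P i x = true).card + 1 ≤ s := by
    intro hsH x
    by_contra hcon
    have hne : H.filter (fun i => sideFn f z P i x = true) ≠ H := by
      intro heq
      have := hTle x
      rw [heq] at this
      omega
    obtain ⟨i, hi, hix⟩ : ∃ i ∈ H, ¬ sideFn f z P i x = true := by
      simpa [Finset.filter_eq_self] using hne
    have := h.card_filter_lt_bSens hs1 hHP hlit hi (by simpa using hix) (B := ∅)
      (by simp) (by simp) (by simp)
    rw [Finset.card_empty] at this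
    omega
  have hlow : s < H.card → ∀ x, s ≤ (H.filter fun i => sideFn f z P i x = true).card + 1 →
      ∀ o ∈ O, sideFn f z P o x = false := by
    intro hsH x hx o ho
    by_contra hox
    have := h.card_le_card_filter_add_one hs1 hHP hlit (hOP ho)
      (fun hoH => Finset.disjoint_left.1 hdisj hoH ho) (by simpa using hox) hx
    have := hHlt hsH x
    omega
  have hHsum := sum_card_filter H (sideFn f z P)
  obtain hO2 | hO2 : O.card ≤ 1 ∨ O.card = 2 := by omega
  · have hsH : s < H.card := by omega
    have hall : ∀ x, s - 1 ≤ (H.filter fun i => sideFn f z P i x = true).card := by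
      by_contra! hex
      obtain ⟨x, hx⟩ := hex
      have hlt := Finset.sum_lt_sum (s := Finset.univ)
        (fun x _ => Nat.le_sub_one_of_lt (hHlt hsH x)) ⟨x, Finset.mem_univ x, hx⟩
      rw [hHsum, hconst] at hlt
      have : (2 * s - 2) * N ≤ H.card * N := Nat.mul_le_mul_right _ (by omega)
      have : (2 * s - 2) * N = 2 * ((s - 1) * N) := by
        rw [← mul_assoc]
        congr 1
        omega
      omega
    rcases Nat.eq_zero_or_pos O.card with hO0 | hO0
    · have hle := Finset.sum_le_sum (s := Finset.univ)
        (fun x _ => Nat.le_sub_one_of_lt (hHlt hsH x))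
      rw [hHsum, hconst] at hle
      have : (2 * s - 1) * N ≤ H.card * N := Nat.mul_le_mul_right _ (by omega)
      have : (2 * s - 1) * N = 2 * ((s - 1) * N) + N := by
        rw [← mul_assoc, ← Nat.succ_mul]
        congr 1
        omega
      omega
    · obtain ⟨o, ho⟩ := Finset.card_pos.1 hO0
      obtain ⟨x, hx⟩ := h.exists_sideFn (hOP ho)
      rw [hlow hsH x (by have := hall x; omega) o ho] at hx
      simp at hx
  · have hHc : H.card + 3 = 2 * s := by omega
    have hHN : H.card * N + 3 * N = 2 * (s * N) := by
      rw [← add_mul, hHc, mul_assoc]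
    rw [hO2] at hOcount
    have hT : ∀ x, (H.filter fun i => sideFn f z P i x = true).card +
        (O.filter fun i => sideFn f z P i x = true).card = s := by
      by_contra! hex
      obtain ⟨x, hx⟩ := hex
      have hlt := Finset.sum_lt_sum (s := Finset.univ) (fun x _ => hTle x)
        ⟨x, Finset.mem_univ x, lt_of_le_of_ne (hTle x) hx⟩
      rw [hTsum, hconst] at hlt
      omega
    rcases hs0.eq_or_lt with hs3 | hs4
    · obtain ⟨o, ho, hall⟩ := h.exists_forall_sideFn hs1 (by omega) hHP hOP hdisj hlit (by omega)
        hO2 (by simpa [← hs3] using hT)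
      have hfull := countTrue_of_forall hall
      obtain ⟨p, hp⟩ := Finset.card_eq_one.1 ((Finset.card_erase_of_mem ho).trans (by rw [hO2]))
      have hpO : p ∈ O := Finset.mem_of_mem_erase (by rw [hp]; simp : p ∈ O.erase o)
      have hp34 := hO34 p hpO
      rw [← Finset.add_sum_erase O _ ho, hp, Finset.sum_singleton] at htotal
      omega
    · have hsH : s < H.card := by omega
      obtain ⟨x, hx⟩ : ∃ x, s - 1 ≤ (H.filter fun i => sideFn f z P i x = true).card := by
        by_contra! hcon
        have hle := Finset.sum_le_sum (s := Finset.univ)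
          (fun x _ => Nat.le_sub_one_of_lt (hcon x))
        rw [hHsum, hconst] at hle
        have : s * N = (s - 1 - 1) * N + 2 * N := by
          rw [← add_mul]
          congr 1
          omega
        omega
      have hOempty : O.filter (fun i => sideFn f z P i x = true) = ∅ :=
        Finset.filter_false_of_mem fun o ho => by
          rw [hlow hsH x (by omega) o ho]
          simp
      have hTx := hT x
      have := hHlt hsH x
      rw [hOempty, Finset.card_empty] at hTx
      omega

end IsMinCert

/-- **Theorem 10.** If `f` is non-constant with `s₁(f) = 2` and `s₀(f) ≥ 3`,
then `C₀(f) ≤ 2·s₀(f) − 2`. -/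
theorem cert0_le_two_sens0_sub_two {n : ℕ} (f : (Fin n → Bool) → Bool)
    (hnc : NonConstant f) (hs1 : bSens f true = 2) (hs0 : 3 ≤ bSens f false) :
    bCert f false ≤ 2 * bSens f false - 2 := by
  refine Finset.sup_le fun z hz => ?_
  obtain ⟨P, hP, hcard⟩ := exists_isMinCert (Finset.mem_filter.1 hz).2
  exact hcard ▸ hP.card_le hs1 hs0
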